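/- arXiv:2505.14991 — 9 statements merged into one kernel-verified Lean document; each statement's English description precedes it below -/
import Mathlib

section
/- The set K, equipped with the subspace topology induced from the product topology on ℤ → ℝ, is homeomorphic to the closed unit disk {p ∈ ℝ² : ‖p‖ ≤ 1} (with the Euclidean norm). -/
/-- The closure of the image of the projectivized stability manifold of a generic
analytic K3 surface under the mass map, in normalized coordinates: the set of
functions `f : ℤ → ℝ` of the form `f k = w + v * |x - k|` with `v, w ≥ 0`,
normalized by `f 0 + f 1 = 1`. -/
def K : Set (ℤ → ℝ) :=
  {f | (∃ x v w : ℝ, 0 ≤ v ∧ 0 ≤ w ∧ ∀ k : ℤ, f k = w + v * |x - (k : ℝ)|) ∧ f 0 + f 1 = 1}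

/-- The triangle `|z 1| ≤ z 0 ≤ 1` in the Euclidean plane. -/
def triangle : Set (EuclideanSpace ℝ (Fin 2)) := {z | |z 1| ≤ z 0 ∧ z 0 ≤ 1}

theorem convex_triangle : Convex ℝ triangle := by
  rintro a ⟨ha, ha'⟩ b ⟨hb, hb'⟩ r s hr hs hrs
  rw [abs_le] at ha hb
  refine ⟨abs_le.2 ⟨?_, ?_⟩, ?_⟩ <;> simp only [PiLp.add_apply, PiLp.smul_apply, smul_eq_mul] <;>
    nlinarith

theorem isClosed_triangle : IsClosed triangle :=
  (isClosed_le (f := fun z : EuclideanSpace ℝ (Fin 2) => |z 1|) (g := fun z => z 0)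
    (by fun_prop) (by fun_prop)).inter
    (isClosed_le (f := fun z : EuclideanSpace ℝ (Fin 2) => z 0) (by fun_prop) continuous_const)

theorem isBounded_triangle : Bornology.IsBounded triangle := by
  refine (Metric.isBounded_closedBall (x := 0) (r := 2)).subset ?_
  rintro z ⟨h1, h2⟩
  rw [mem_closedBall_zero_iff, EuclideanSpace.norm_eq, Fin.sum_univ_two]
  rw [abs_le] at h1
  refine Real.sqrt_le_iff.2 ⟨by norm_num, ?_⟩
  simp only [Real.norm_eq_abs, sq_abs]
  nlinarith

theorem isCompact_triangle : IsCompact triangle :=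
  Metric.isCompact_of_isClosed_isBounded isClosed_triangle isBounded_triangle

theorem interior_triangle_nonempty : (interior triangle).Nonempty := by
  have ho : IsOpen {z : EuclideanSpace ℝ (Fin 2) | |z 1| < z 0 ∧ z 0 < 1} :=
    (isOpen_lt (f := fun z : EuclideanSpace ℝ (Fin 2) => |z 1|) (g := fun z => z 0)
      (by fun_prop) (by fun_prop)).inter
      (isOpen_lt (f := fun z : EuclideanSpace ℝ (Fin 2) => z 0) (by fun_prop) continuous_const)
  refine ⟨!₂[1 / 2, 0], interior_maximal ?_ ho ?_⟩
  · exact fun z hz => ⟨hz.1.le, hz.2.le⟩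
  · constructor <;> norm_num

theorem nonempty_triangle_homeomorph_disk :
    Nonempty (triangle ≃ₜ {p : EuclideanSpace ℝ (Fin 2) // ‖p‖ ≤ 1}) := by
  obtain ⟨h, -, hcl, -⟩ := exists_homeomorph_image_interior_closure_frontier_eq_unitBall
    convex_triangle interior_triangle_nonempty isBounded_triangle
  rw [isClosed_triangle.closure_eq] at hcl
  refine ⟨(h.image triangle).trans (Homeomorph.setCongr (hcl.trans ?_))⟩
  ext p
  exact mem_closedBall_zero_iff

/-- The normalized mass function with slope `p` and center `x`, where `s = p * (x - 1 / 2)`. -/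
noncomputable def massFun (p s : ℝ) (k : ℤ) : ℝ :=
  1 / 2 + |s - p * (k - 1 / 2)| - (|s + p / 2| + |s - p / 2|) / 2

theorem abs_massFun_sub_half_le (p s : ℝ) (k : ℤ) :
    |massFun p s k - 1 / 2| ≤ |p| * (|(k : ℝ)| + 1) := by
  have e : massFun p s k - 1 / 2 = (|s - p * (k - 1 / 2)| - |s + p / 2|) / 2
      + (|s - p * (k - 1 / 2)| - |s - p / 2|) / 2 := by unfold massFun; ring
  have h1 := abs_abs_sub_abs_le_abs_sub (s - p * (k - 1 / 2)) (s + p / 2)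
  have h2 := abs_abs_sub_abs_le_abs_sub (s - p * (k - 1 / 2)) (s - p / 2)
  rw [show s - p * (k - 1 / 2) - (s + p / 2) = -(p * k) by ring, abs_neg, abs_mul] at h1
  rw [show s - p * (k - 1 / 2) - (s - p / 2) = p * (1 - k) by ring, abs_mul] at h2
  have h3 : |1 - (k : ℝ)| ≤ |(k : ℝ)| + 1 := by
    have := abs_sub (1 : ℝ) k
    rw [abs_one] at this
    linarith
  have h4 := mul_le_mul_of_nonneg_left h3 (abs_nonneg p)
  have h5 := abs_nonneg p
  rw [abs_le] at h1 h2
  rw [e, abs_le]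
  constructor <;> linarith

theorem massFun_mem_K {p s : ℝ} (hp : 0 ≤ p) (hp1 : p ≤ 1) (hs : |s| ≤ 1 / 2)
    (h0 : p = 0 → s = 0) : massFun p s ∈ K := by
  rw [abs_le] at hs
  constructor
  · rcases hp.eq_or_lt with rfl | hp
    · exact ⟨0, 0, 1 / 2, le_rfl, by norm_num, fun k => by simp [massFun, h0 rfl]⟩
    · refine ⟨1 / 2 + s / p, p, 1 / 2 - (|s + p / 2| + |s - p / 2|) / 2, hp.le, ?_, fun k => ?_⟩
      · rcases abs_cases (s + p / 2) with h | h <;> rcases abs_cases (s - p / 2) with h' | h' <;>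
          linarith
      · have : s - p * (k - 1 / 2) = p * (1 / 2 + s / p - k) := by field_simp; ring
        rw [massFun, this, abs_mul, abs_of_pos hp]
        ring
  · rw [massFun, massFun, show s - p * (((0 : ℤ) : ℝ) - 1 / 2) = s + p / 2 by push_cast; ring,
      show s - p * (((1 : ℤ) : ℝ) - 1 / 2) = s - p / 2 by push_cast; ring]
    ring

theorem exists_massFun_eq {f : ℤ → ℝ} (hf : f ∈ K) :
    ∃ p s : ℝ, 0 ≤ p ∧ p ≤ 1 ∧ |s| ≤ 1 / 2 ∧ (p = 0 → s = 0) ∧ massFun p s = f := by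
  obtain ⟨⟨x, v, w, hv, hw, h⟩, h1⟩ := hf
  have e (k : ℤ) : v * |x - k| = |v * (x - 1 / 2) - v * (k - 1 / 2)| := by
    rw [← mul_sub, abs_mul, abs_of_nonneg hv]
    ring_nf
  have hk (k : ℤ) := (h k).trans (congrArg (w + ·) (e k))
  rw [hk, hk, show v * (x - 1 / 2) - v * (((0 : ℤ) : ℝ) - 1 / 2) = v * (x - 1 / 2) + v / 2 by
      push_cast; ring, show v * (x - 1 / 2) - v * (((1 : ℤ) : ℝ) - 1 / 2)
      = v * (x - 1 / 2) - v / 2 by push_cast; ring] at h1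
  refine ⟨v, v * (x - 1 / 2), hv, ?_, abs_le.2 ⟨?_, ?_⟩, fun h => by simp [h], ?_⟩
  · linarith [le_abs_self (v * (x - 1 / 2) + v / 2), neg_abs_le (v * (x - 1 / 2) - v / 2)]
  · linarith [neg_abs_le (v * (x - 1 / 2) + v / 2), neg_abs_le (v * (x - 1 / 2) - v / 2)]
  · linarith [le_abs_self (v * (x - 1 / 2) + v / 2), le_abs_self (v * (x - 1 / 2) - v / 2)]
  · funext k
    rw [hk, massFun]
    linarith

theorem massFun_of_abs_le {p s : ℝ} {N : ℤ} (h : |s| ≤ p * (N - 1 / 2)) :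
    massFun p s N = 1 / 2 + p * (N - 1 / 2) - s - (|s + p / 2| + |s - p / 2|) / 2 ∧
    massFun p s (1 - N) = 1 / 2 + p * (N - 1 / 2) + s - (|s + p / 2| + |s - p / 2|) / 2 := by
  rw [abs_le] at h
  constructor
  · rw [massFun, abs_of_nonpos (by linarith : s - p * (N - 1 / 2) ≤ 0)]
    ring
  · have e : s - p * (((1 - N : ℤ) : ℝ) - 1 / 2) = s + p * (N - 1 / 2) := by push_cast; ring
    rw [massFun, e, abs_of_nonneg (by linarith : 0 ≤ s + p * (N - 1 / 2))]
    ring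

theorem exists_forall_abs_le {p s : ℝ} (hp : 0 ≤ p) (h0 : p = 0 → s = 0) :
    ∃ N : ℤ, ∀ M : ℤ, N ≤ M → |s| ≤ p * (M - 1 / 2) := by
  rcases hp.eq_or_lt with rfl | hp
  · exact ⟨0, fun M _ => by simp [h0 rfl]⟩
  · refine ⟨⌈|s| / p + 1 / 2⌉, fun M hM => ?_⟩
    have := Int.ceil_le.1 hM
    rw [← div_le_iff₀' hp]
    linarith

theorem massFun_injective {p s p' s' : ℝ} (hp : 0 ≤ p) (h0 : p = 0 → s = 0) (hp' : 0 ≤ p')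
    (h0' : p' = 0 → s' = 0) (h : massFun p s = massFun p' s') : p = p' ∧ s = s' := by
  obtain ⟨N, hN⟩ := exists_forall_abs_le hp h0
  obtain ⟨N', hN'⟩ := exists_forall_abs_le hp' h0'
  set M := max N N'
  obtain ⟨a1, a2⟩ := massFun_of_abs_le (hN M (le_max_left _ _))
  obtain ⟨b1, b2⟩ := massFun_of_abs_le (hN' M (le_max_right _ _))
  obtain ⟨c1, -⟩ := massFun_of_abs_le (hN (M + 1) ((le_max_left N N').trans (le_add_of_nonneg_right zero_le_one)))
  obtain ⟨d1, -⟩ := massFun_of_abs_le (hN' (M + 1) ((le_max_right N N').trans (le_add_of_nonneg_right zero_le_one)))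
  rw [h] at a1 a2 c1
  push_cast at c1 d1
  constructor <;> linarith

/-- The mass function attached to a point of the triangle: `z 0` is the slope, and collapsing the
edge of slope zero accounts for the division by `z 0`. -/
noncomputable def triangleMass (z : EuclideanSpace ℝ (Fin 2)) : ℤ → ℝ :=
  massFun (z 0) (z 1 / (2 * z 0))

theorem continuous_triangleMass : Continuous triangleMass := by
  refine continuous_pi fun k => continuous_iff_continuousAt.2 fun z => ?_
  by_cases hz : z 0 = 0
  · have e : triangleMass z k = 1 / 2 := by simp [triangleMass, massFun, hz]
    rw [ContinuousAt, e, tendsto_iff_dist_tendsto_zero]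
    have hc : Continuous fun y : EuclideanSpace ℝ (Fin 2) => |y 0| * (|(k : ℝ)| + 1) := by
      fun_prop
    have ht := hc.tendsto z
    rw [hz, abs_zero, zero_mul] at ht
    exact squeeze_zero (fun _ => dist_nonneg) (fun y => abs_massFun_sub_half_le _ _ k) ht
  · have h2 : 2 * z 0 ≠ 0 := mul_ne_zero two_ne_zero hz
    unfold triangleMass massFun
    fun_prop (disch := assumption)

theorem abs_div_two_mul_le {z : EuclideanSpace ℝ (Fin 2)} (hz : z ∈ triangle) :
    |z 1 / (2 * z 0)| ≤ 1 / 2 := by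
  have h0 : 0 ≤ z 0 := (abs_nonneg _).trans hz.1
  rw [abs_div, abs_of_nonneg (by positivity : 0 ≤ 2 * z 0)]
  exact div_le_of_le_mul₀ (by positivity) (by norm_num) (by linarith [hz.1])

theorem bijOn_triangleMass : Set.BijOn triangleMass triangle K := by
  refine ⟨fun z hz => ?_, fun z hz y hy h => ?_, fun f hf => ?_⟩
  · exact massFun_mem_K ((abs_nonneg _).trans hz.1) hz.2 (abs_div_two_mul_le hz)
      fun h => by simp [h]
  · obtain ⟨h0, h1⟩ := massFun_injective ((abs_nonneg _).trans hz.1) (fun h => by simp [h])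
      ((abs_nonneg _).trans hy.1) (fun h => by simp [h]) h
    have h1' : z 1 = y 1 := by
      by_cases hz0 : z 0 = 0
      · have a := hz.1
        have b := hy.1
        rw [hz0] at a
        rw [← h0, hz0] at b
        rw [abs_nonpos_iff.1 a, abs_nonpos_iff.1 b]
      · rw [← h0] at h1
        field_simp at h1
        exact h1
    ext i
    fin_cases i
    exacts [h0, h1']
  · obtain ⟨p, s, hp, hp1, hs, h0, rfl⟩ := exists_massFun_eq hf
    refine ⟨!₂[p, 2 * p * s], ⟨?_, ?_⟩, ?_⟩
    · simp only [Matrix.cons_val_zero, Matrix.cons_val_one]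
      rw [abs_mul, abs_of_nonneg (by positivity : 0 ≤ 2 * p)]
      nlinarith
    · simpa using hp1
    · simp only [triangleMass, Matrix.cons_val_zero, Matrix.cons_val_one]
      rcases eq_or_ne p 0 with rfl | hp0
      · simp [h0 rfl]
      · rw [mul_div_cancel_left₀ _ (mul_ne_zero two_ne_zero hp0)]

theorem nonempty_triangle_homeomorph_K : Nonempty (triangle ≃ₜ K) := by
  have : CompactSpace triangle := isCompact_iff_compactSpace.1 isCompact_triangle
  have hc : Continuous (bijOn_triangleMass.equiv triangleMass) :=
    continuous_triangleMass.continuousOn.mapsToRestrict bijOn_triangleMass.mapsTo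
  exact ⟨hc.homeoOfEquivCompactToT2⟩

/-- `K`, with the subspace topology induced from the product topology on `ℤ → ℝ`,
is homeomorphic to the closed unit disk in the Euclidean plane. -/
theorem stmt_0 : Nonempty (K ≃ₜ {p : EuclideanSpace ℝ (Fin 2) // ‖p‖ ≤ 1}) := by
  obtain ⟨e⟩ := nonempty_triangle_homeomorph_K
  obtain ⟨d⟩ := nonempty_triangle_homeomorph_disk
  exact ⟨e.symm.trans d⟩
end

section
/- The set K is a compact subset of the space of functions ℤ → ℝ with the product topology. -/
/-- Writing `a = v * x`, the set `K` is the image of a closed and bounded set of parameters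
`(a, v, w)` under `f k = w + |a - v * k|`; the case `v = 0` gives constant functions. -/
theorem K_eq_image :
    K = (fun (p : ℝ × ℝ × ℝ) (k : ℤ) => p.2.2 + |p.1 - p.2.1 * (k : ℝ)|) ''
      {p | 0 ≤ p.2.1 ∧ 0 ≤ p.2.2 ∧ 2 * p.2.2 + |p.1| + |p.1 - p.2.1| = 1} := by
  ext f
  constructor
  · rintro ⟨⟨x, v, w, hv, hw, hf⟩, h⟩
    have key : ∀ k : ℤ, f k = w + |v * x - v * (k : ℝ)| := fun k => by
      rw [hf, ← mul_sub, abs_mul, abs_of_nonneg hv]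
    refine ⟨(v * x, v, w), ⟨hv, hw, ?_⟩, funext fun k => (key k).symm⟩
    rw [key, key] at h
    simp only [Int.cast_zero, Int.cast_one, mul_zero, mul_one, sub_zero] at h
    linarith
  · rintro ⟨⟨a, v, w⟩, ⟨hv, hw, h⟩, rfl⟩
    dsimp only at hv hw h
    refine ⟨?_, ?_⟩
    · rcases hv.eq_or_lt with rfl | hpos
      · exact ⟨0, 0, w + |a|, le_rfl, by positivity, fun k => by simp⟩
      · refine ⟨a / v, v, w, hv, hw, fun k => ?_⟩
        have hx : a - v * (k : ℝ) = v * (a / v - k) := by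
          field_simp
        simp only [hx, abs_mul, abs_of_nonneg hv]
    · simp only [Int.cast_zero, Int.cast_one, mul_zero, mul_one, sub_zero]
      linarith

/-- `K` is a compact subset of `ℤ → ℝ` with the product topology. -/
theorem stmt_1 : IsCompact K := by
  rw [K_eq_image]
  refine IsCompact.image ?_ (by fun_prop)
  have hbox : IsCompact (Set.Icc (-1 : ℝ) 1 ×ˢ Set.Icc (0 : ℝ) 1 ×ˢ Set.Icc (0 : ℝ) 1) :=
    isCompact_Icc.prod (isCompact_Icc.prod isCompact_Icc)
  refine hbox.of_isClosed_subset ?_ ?_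
  · have hv : IsClosed {p : ℝ × ℝ × ℝ | 0 ≤ p.2.1} := isClosed_le (by fun_prop) (by fun_prop)
    have hw : IsClosed {p : ℝ × ℝ × ℝ | 0 ≤ p.2.2} := isClosed_le (by fun_prop) (by fun_prop)
    have hsum : IsClosed {p : ℝ × ℝ × ℝ | 2 * p.2.2 + |p.1| + |p.1 - p.2.1| = 1} :=
      isClosed_eq (by fun_prop) (by fun_prop)
    exact hv.inter (hw.inter hsum)
  · rintro ⟨a, v, w⟩ ⟨hv, hw, h⟩
    dsimp only at hv hw h
    have h₁ := le_abs_self a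
    have h₂ := neg_abs_le a
    have h₃ := neg_abs_le (a - v)
    have h₄ := abs_nonneg a
    have h₅ := abs_nonneg (a - v)
    exact ⟨⟨by linarith, by linarith⟩, ⟨hv, by linarith⟩, ⟨hw, by linarith⟩⟩
end

section
/- The closure of D in the space ℤ → ℝ (with the product topology) equals K, and D is an open subset of K in the subspace topology. -/
/-- The image of the projectivized stability manifold under the mass map, in
normalized coordinates: those `f` as in `K` but with `v, w > 0`. -/
def D : Set (ℤ → ℝ) :=
  {f | (∃ x v w : ℝ, 0 < v ∧ 0 < w ∧ ∀ k : ℤ, f k = w + v * |x - (k : ℝ)|) ∧ f 0 + f 1 = 1}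

open Filter Topology in
theorem K_subset_closure_D : K ⊆ closure D := by
  rintro f ⟨⟨x, v, w, hv, hw, hf⟩, hsum⟩
  set c : ℝ := 2 + (|x| + |x - 1|) with hc
  have hc0 : 0 < c := by positivity
  have hlim : Tendsto (fun t : ℝ => fun k : ℤ => (f k + t * (1 + |x - (k : ℝ)|)) / (1 + t * c))
      (𝓝[>] 0) (𝓝 f) := by
    rw [tendsto_pi_nhds]
    intro k
    have h : ContinuousAt (fun t : ℝ => (f k + t * (1 + |x - (k : ℝ)|)) / (1 + t * c)) 0 :=
      ContinuousAt.div (by fun_prop) (by fun_prop) (by simp)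
    have h' := h.tendsto
    simp only [zero_mul, add_zero, div_one] at h'
    exact h'.mono_left nhdsWithin_le_nhds
  refine mem_closure_of_tendsto hlim ?_
  filter_upwards [self_mem_nhdsWithin] with t ht
  have ht : 0 < t := ht
  have hZ : 0 < 1 + t * c := by positivity
  refine ⟨⟨x, (v + t) / (1 + t * c), (w + t) / (1 + t * c), by positivity, by positivity,
    fun k => ?_⟩, ?_⟩
  · simp only [hf k]
    field_simp
    ring
  · rw [← add_div, div_eq_one_iff_eq hZ.ne']
    push_cast
    rw [sub_zero]
    linear_combination hsum - t * hc

/-- The function `k ↦ w + |a - b * k|` attached to a triple `(a, b, w)`. For `b > 0` this is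
`k ↦ w + v * |x - k|` with `v = b` and `x = a / b`. -/
def massOfParam (p : ℝ × ℝ × ℝ) (k : ℤ) : ℝ :=
  p.2.2 + |p.1 - p.2.1 * (k : ℝ)|

/-- The normalized parameters. -/
def paramSet : Set (ℝ × ℝ × ℝ) :=
  {p | 0 ≤ p.2.1 ∧ 0 ≤ p.2.2 ∧ massOfParam p 0 + massOfParam p 1 = 1}

theorem continuous_massOfParam : Continuous massOfParam := by
  unfold massOfParam
  fun_prop

theorem isCompact_paramSet : IsCompact paramSet := by
  have hclosed : IsClosed paramSet := by
    have h (k : ℤ) : Continuous fun p => massOfParam p k :=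
      (continuous_apply k).comp continuous_massOfParam
    exact (isClosed_le continuous_const continuous_snd.fst).inter
      ((isClosed_le continuous_const continuous_snd.snd).inter
        (isClosed_eq ((h 0).add (h 1)) continuous_const))
  refine (isCompact_Icc (a := ((-1, 0, 0) : ℝ × ℝ × ℝ)) (b := (1, 1, 1))).of_isClosed_subset
    hclosed ?_
  rintro ⟨a, b, w⟩ ⟨hb, hw, h⟩
  simp only [massOfParam, Int.cast_zero, Int.cast_one, mul_zero, mul_one, sub_zero] at hb hw h
  have h1 := le_abs_self a
  have h2 := neg_le_abs a
  have h3 := neg_le_abs (a - b)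
  have h4 := abs_nonneg (a - b)
  refine ⟨⟨?_, ?_, ?_⟩, ⟨?_, ?_, ?_⟩⟩ <;> simp only <;> linarith

theorem massOfParam_mul {v : ℝ} (hv : 0 ≤ v) (x w : ℝ) (k : ℤ) :
    massOfParam (v * x, v, w) k = w + v * |x - (k : ℝ)| := by
  simp only [massOfParam]
  rw [← mul_sub, abs_mul, abs_of_nonneg hv]

theorem exists_mem_paramSet_of_mem_K {f : ℤ → ℝ} (hf : f ∈ K) :
    ∃ p ∈ paramSet, massOfParam p = f := by
  obtain ⟨⟨x, v, w, hv, hw, hf⟩, hsum⟩ := hf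
  have h : massOfParam (v * x, v, w) = f :=
    funext fun k => (massOfParam_mul hv x w k).trans (hf k).symm
  exact ⟨(v * x, v, w), ⟨hv, hw, by rw [h, hsum]⟩, h⟩

theorem massOfParam_mem_D {p : ℝ × ℝ × ℝ} (hp : p ∈ paramSet) (hb : 0 < p.2.1)
    (hw : 0 < p.2.2) : massOfParam p ∈ D := by
  obtain ⟨a, b, w⟩ := p
  refine ⟨⟨a / b, b, w, hb, hw, fun k => ?_⟩, hp.2.2⟩
  rw [← massOfParam_mul hb.le, mul_div_cancel₀ a (ne_of_gt hb)]

theorem massOfParam_mem_K {p : ℝ × ℝ × ℝ} (hp : p ∈ paramSet) : massOfParam p ∈ K := by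
  obtain ⟨a, b, w⟩ := p
  obtain ⟨hb, hw, hsum⟩ := hp
  refine ⟨?_, hsum⟩
  rcases (show 0 ≤ b from hb).eq_or_lt with rfl | hb'
  · exact ⟨0, 0, w + |a|, le_rfl, add_nonneg hw (abs_nonneg a), fun k => by simp [massOfParam]⟩
  · refine ⟨a / b, b, w, hb, hw, fun k => ?_⟩
    rw [← massOfParam_mul hb, mul_div_cancel₀ a hb'.ne']

theorem isClosed_K : IsClosed K := by
  have h : K = massOfParam '' paramSet := by
    ext f
    refine ⟨exists_mem_paramSet_of_mem_K, ?_⟩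
    rintro ⟨p, hp, rfl⟩
    exact massOfParam_mem_K hp
  rw [h]
  exact (isCompact_paramSet.image continuous_massOfParam).isClosed

/-- The parameters `v` and `w` are determined by the function `k ↦ w + v * |x - k|` on `ℤ`. -/
theorem eq_of_forall_add_mul_abs_eq {x v w x' v' w' : ℝ}
    (h : ∀ k : ℤ, w + v * |x - (k : ℝ)| = w' + v' * |x' - (k : ℝ)|) : v = v' ∧ w = w' := by
  obtain ⟨n, hn⟩ := exists_int_gt (max |x| |x'|)
  obtain ⟨hx, hx'⟩ := max_lt_iff.1 hn
  rw [abs_lt] at hx hx'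
  have h1 := h n
  have h2 := h (n + 1)
  have h3 := h (-n)
  push_cast at h2 h3
  rw [abs_of_neg (by linarith), abs_of_neg (by linarith)] at h1 h2
  rw [abs_of_pos (by linarith), abs_of_pos (by linarith)] at h3
  have hv : v = v' := by linarith
  subst hv
  exact ⟨rfl, by linarith⟩

theorem massOfParam_notMem_D {p : ℝ × ℝ × ℝ} (hp : p ∈ paramSet)
    (h : p.2.1 = 0 ∨ p.2.2 = 0) : massOfParam p ∉ D := by
  obtain ⟨a, b, w⟩ := p
  rintro ⟨⟨x', v', w', hv', hw', hf⟩, -⟩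
  rcases (show 0 ≤ b from hp.1).eq_or_lt with rfl | hb
  · have := (eq_of_forall_add_mul_abs_eq (x := 0) (v := 0) (w := w + |a|) (x' := x')
      (v' := v') (w' := w') fun k => by rw [← hf k]; simp [massOfParam]).1
    exact hv'.ne this
  · have hw : w = 0 := h.resolve_left hb.ne'
    have := (eq_of_forall_add_mul_abs_eq (x := a / b) (v := b) (w := w) (x' := x')
      (v' := v') (w' := w') fun k => by
        rw [← hf k, ← massOfParam_mul hb.le, mul_div_cancel₀ a hb.ne']).2
    exact hw'.ne (hw.symm.trans this)

theorem isClosed_K_diff_D : IsClosed (K \ D) := by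
  have h : K \ D = massOfParam '' (paramSet ∩ {p | p.2.1 = 0 ∨ p.2.2 = 0}) := by
    ext f
    constructor
    · rintro ⟨hK, hD⟩
      obtain ⟨p, hp, rfl⟩ := exists_mem_paramSet_of_mem_K hK
      refine ⟨p, ⟨hp, ?_⟩, rfl⟩
      by_contra! hne
      rw [Set.mem_ofPred_eq, not_or] at hne
      exact hD (massOfParam_mem_D hp (hp.1.lt_of_ne' hne.1) (hp.2.1.lt_of_ne' hne.2))
    · rintro ⟨p, ⟨hp, h0⟩, rfl⟩
      exact ⟨massOfParam_mem_K hp, massOfParam_notMem_D hp h0⟩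
  rw [h]
  have hclosed : IsClosed {p : ℝ × ℝ × ℝ | p.2.1 = 0 ∨ p.2.2 = 0} :=
    (isClosed_eq (by fun_prop) continuous_const).union
      (isClosed_eq (by fun_prop) continuous_const)
  exact ((isCompact_paramSet.inter_right hclosed).image continuous_massOfParam).isClosed

theorem D_subset_K : D ⊆ K := by
  rintro f ⟨⟨x, v, w, hv, hw, hf⟩, hsum⟩
  exact ⟨⟨x, v, w, hv.le, hw.le, hf⟩, hsum⟩

/-- The closure of `D` in `ℤ → ℝ` (product topology) is `K`, and `D` is open in
`K` for the subspace topology. -/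
theorem stmt_2 : closure D = K ∧ IsOpen {f : K | (f : ℤ → ℝ) ∈ D} := by
  refine ⟨(closure_minimal D_subset_K isClosed_K).antisymm K_subset_closure_D, ?_⟩
  have h : {f : K | (f : ℤ → ℝ) ∈ D} = Subtype.val ⁻¹' (K \ D)ᶜ := by
    ext f
    simp
  rw [h]
  exact isClosed_K_diff_D.isOpen_compl.preimage continuous_subtype_val
end

section
/- The set D, with the subspace topology induced from the product topology on ℤ → ℝ, is homeomorphic to ℝ² (equivalently, to the open unit disk). -/
/-- The function `k ↦ w + v * |x - k|` normalized to have `f 0 + f 1 = 1`, in terms of the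
vertex `x = p.1` and the logarithm `p.2 = log (w / v)`. -/
noncomputable def normalizedAbs (p : ℝ × ℝ) (k : ℤ) : ℝ :=
  (Real.exp p.2 + |p.1 - (k : ℝ)|) / (2 * Real.exp p.2 + |p.1| + |p.1 - 1|)

/-- A left inverse of `normalizedAbs` on vertices of absolute value at most `N`. -/
noncomputable def vertexChart (N : ℤ) (f : ℤ → ℝ) : ℝ × ℝ :=
  ((f (-N) - f N) / (2 * (f (N + 1) - f N)),
    Real.log ((f N + f (-N)) / (2 * (f (N + 1) - f N)) - N))

lemma normalizedAbs_denom_pos (p : ℝ × ℝ) : 0 < 2 * Real.exp p.2 + |p.1| + |p.1 - 1| := by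
  positivity

lemma continuous_normalizedAbs : Continuous normalizedAbs := by
  refine continuous_pi fun k => ?_
  unfold normalizedAbs
  exact Continuous.div (by fun_prop) (by fun_prop) fun p => (normalizedAbs_denom_pos p).ne'

lemma normalizedAbs_mem_D (p : ℝ × ℝ) : normalizedAbs p ∈ D := by
  have h := normalizedAbs_denom_pos p
  refine ⟨⟨p.1, 1 / (2 * Real.exp p.2 + |p.1| + |p.1 - 1|),
    Real.exp p.2 / (2 * Real.exp p.2 + |p.1| + |p.1 - 1|), by positivity, by positivity,
    fun k => ?_⟩, ?_⟩
  · unfold normalizedAbs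
    ring
  · simp only [normalizedAbs, Int.cast_zero, Int.cast_one, sub_zero]
    field_simp
    ring

lemma exists_normalizedAbs_eq {f : ℤ → ℝ} (hf : f ∈ D) : ∃ p, normalizedAbs p = f := by
  obtain ⟨⟨x, v, w, hv, hw, h⟩, h1⟩ := hf
  refine ⟨(x, Real.log (w / v)), funext fun k => ?_⟩
  have hsum : 2 * w + v * (|x| + |x - 1|) = 1 := by
    rw [h 0, h 1, Int.cast_zero, Int.cast_one, sub_zero] at h1
    linarith
  have hden : 2 * (w / v) + |x| + |x - 1| = 1 / v := by
    field_simp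
    linarith
  rw [normalizedAbs, Real.exp_log (by positivity), hden, h k]
  field_simp

lemma normalizedAbs_succ_sub {p : ℝ × ℝ} {N : ℤ} (hN : |p.1| ≤ N) :
    normalizedAbs p (N + 1) - normalizedAbs p N
      = 1 / (2 * Real.exp p.2 + |p.1| + |p.1 - 1|) := by
  obtain ⟨h1, h2⟩ := abs_le.1 hN
  rw [normalizedAbs, normalizedAbs, Int.cast_add, Int.cast_one,
    abs_of_nonpos (by linarith : p.1 - ((N : ℝ) + 1) ≤ 0),
    abs_of_nonpos (by linarith : p.1 - (N : ℝ) ≤ 0)]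
  ring

lemma normalizedAbs_add_neg {p : ℝ × ℝ} {N : ℤ} (hN : |p.1| ≤ N) :
    (normalizedAbs p N + normalizedAbs p (-N)) /
      (2 * (normalizedAbs p (N + 1) - normalizedAbs p N)) - N = Real.exp p.2 := by
  have h := normalizedAbs_denom_pos p
  rw [normalizedAbs_succ_sub hN]
  obtain ⟨h1, h2⟩ := abs_le.1 hN
  rw [normalizedAbs, normalizedAbs, Int.cast_neg,
    abs_of_nonpos (by linarith : p.1 - (N : ℝ) ≤ 0),
    abs_of_nonneg (by linarith : 0 ≤ p.1 - (-(N : ℝ)))]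
  field_simp
  ring

lemma vertexChart_normalizedAbs {p : ℝ × ℝ} {N : ℤ} (hN : |p.1| ≤ N) :
    vertexChart N (normalizedAbs p) = p := by
  have h := normalizedAbs_denom_pos p
  refine Prod.ext ?_ ?_
  · simp only [vertexChart]
    rw [normalizedAbs_succ_sub hN]
    obtain ⟨h1, h2⟩ := abs_le.1 hN
    rw [normalizedAbs, normalizedAbs, Int.cast_neg,
      abs_of_nonpos (by linarith : p.1 - (N : ℝ) ≤ 0),
      abs_of_nonneg (by linarith : 0 ≤ p.1 - (-(N : ℝ)))]
    field_simp
    ring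
  · simp only [vertexChart]
    rw [normalizedAbs_add_neg hN, Real.log_exp]

lemma continuousAt_vertexChart {p : ℝ × ℝ} {N : ℤ} (hN : |p.1| ≤ N) :
    ContinuousAt (vertexChart N) (normalizedAbs p) := by
  have hd : 2 * (normalizedAbs p (N + 1) - normalizedAbs p N) ≠ 0 := by
    rw [normalizedAbs_succ_sub hN]
    have := normalizedAbs_denom_pos p
    positivity
  have hl := (Real.exp_pos p.2).ne'
  rw [← normalizedAbs_add_neg hN] at hl
  have hden : ContinuousAt (fun f : ℤ → ℝ => 2 * (f (N + 1) - f N)) (normalizedAbs p) := by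
    fun_prop
  refine ContinuousAt.prodMk (ContinuousAt.div (by fun_prop) hden hd) ?_
  refine ContinuousAt.log (ContinuousAt.sub (ContinuousAt.div ?_ hden hd) continuousAt_const) hl
  fun_prop

lemma normalizedAbs_lt_iff {p : ℝ × ℝ} {a b : ℤ} :
    normalizedAbs p a < normalizedAbs p b ↔ |p.1 - (a : ℝ)| < |p.1 - (b : ℝ)| := by
  rw [normalizedAbs, normalizedAbs, div_lt_div_iff_of_pos_right (normalizedAbs_denom_pos p),
    add_lt_add_iff_left]

lemma normalizedAbs_lt_succ_and_iff {p : ℝ × ℝ} {N : ℤ} :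
    (normalizedAbs p N < normalizedAbs p (N + 1) ∧
      normalizedAbs p (-N) < normalizedAbs p (-(N + 1))) ↔ |p.1| < N + 1 / 2 := by
  rw [normalizedAbs_lt_iff, normalizedAbs_lt_iff, ← sq_lt_sq, ← sq_lt_sq, abs_lt]
  push_cast
  constructor
  · rintro ⟨h1, h2⟩
    constructor <;> linarith
  · rintro ⟨h1, h2⟩
    constructor <;> linarith

lemma injective_normalizedAbs : Function.Injective normalizedAbs := by
  intro p q h
  obtain ⟨N, hN⟩ : ∃ N : ℤ, max |p.1| |q.1| ≤ N := ⟨_, Int.le_ceil _⟩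
  rw [max_le_iff] at hN
  rw [← vertexChart_normalizedAbs hN.1, h, vertexChart_normalizedAbs hN.2]

/-- `normalizedAbs` as a bijection from the plane onto `D`. -/
noncomputable def planeEquivD : (ℝ × ℝ) ≃ D :=
  Equiv.ofBijective (fun p => ⟨normalizedAbs p, normalizedAbs_mem_D p⟩)
    ⟨fun _ _ h => injective_normalizedAbs (congrArg Subtype.val h),
      fun f => (exists_normalizedAbs_eq f.2).imp fun _ h => Subtype.ext h⟩

lemma coe_planeEquivD (p : ℝ × ℝ) : (planeEquivD p : ℤ → ℝ) = normalizedAbs p := rfl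

lemma continuous_planeEquivD_symm : Continuous planeEquivD.symm := by
  refine continuous_iff_continuousAt.2 fun f => ?_
  obtain ⟨p, rfl⟩ := planeEquivD.surjective f
  obtain ⟨N, hN⟩ : ∃ N : ℤ, |p.1| ≤ N := ⟨_, Int.le_ceil _⟩
  have hchart : ContinuousAt (fun f : D => vertexChart (N + 1) f) (planeEquivD p) :=
    ContinuousAt.comp (g := vertexChart (N + 1))
      (continuousAt_vertexChart (hN.trans (by push_cast; linarith)))
      continuous_subtype_val.continuousAt
  refine hchart.congr ?_
  have hcont (k : ℤ) : ContinuousAt (fun f : D => (f : ℤ → ℝ) k) (planeEquivD p) :=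
    ((continuous_apply k).comp continuous_subtype_val).continuousAt
  obtain ⟨h1, h2⟩ := (normalizedAbs_lt_succ_and_iff (N := N)).2 (hN.trans_lt (by linarith))
  filter_upwards [(hcont _).eventually_lt (hcont _) h1, (hcont _).eventually_lt (hcont _) h2]
    with g hg1 hg2
  obtain ⟨q, rfl⟩ := planeEquivD.surjective g
  have hq := normalizedAbs_lt_succ_and_iff.1 ⟨hg1, hg2⟩
  rw [coe_planeEquivD, Equiv.symm_apply_apply]
  exact vertexChart_normalizedAbs (by push_cast at hq ⊢; linarith)

/-- `D`, with the subspace topology induced from the product topology on `ℤ → ℝ`,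
is homeomorphic to `ℝ²`. -/
theorem stmt_3 : Nonempty (D ≃ₜ (ℝ × ℝ)) :=
  ⟨{ planeEquivD.symm with
      continuous_toFun := continuous_planeEquivD_symm
      continuous_invFun := continuous_normalizedAbs.subtype_mk normalizedAbs_mem_D }⟩
end

section
/- Let x, x' ∈ ℝ, let v, v' > 0, let w, w' ≥ 0, and let λ > 0. If w + v·|x − k| = λ·(w' + v'·|x' − k|) for all k ∈ ℤ, then x = x', v = λ·v', and w = λ·w'. -/
/-- Injectivity, up to positive rescaling, of the parametrization
`(x, v, w) ↦ (k ↦ w + v * |x - k|)` of normalized mass functions. -/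
theorem stmt_5 (x x' v v' w w' l : ℝ) (hv : 0 < v) (hv' : 0 < v')
    (hw : 0 ≤ w) (hw' : 0 ≤ w') (hl : 0 < l)
    (h : ∀ k : ℤ, w + v * |x - (k : ℝ)| = l * (w' + v' * |x' - (k : ℝ)|)) :
    x = x' ∧ v = l * v' ∧ w = l * w' := by
  obtain ⟨n, hn⟩ := exists_nat_ge (|x| + |x'|)
  have hx := abs_le.mp (show |x| ≤ n by linarith [abs_nonneg x'])
  have hx' := abs_le.mp (show |x'| ≤ n by linarith [abs_nonneg x])
  have h₁ := h n
  have h₂ := h (n + 1)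
  have h₃ := h (-n)
  push_cast at h₁ h₂ h₃
  rw [abs_of_nonpos (by linarith), abs_of_nonpos (by linarith)] at h₁ h₂
  rw [abs_of_nonneg (by linarith), abs_of_nonneg (by linarith)] at h₃
  have hvv : v = l * v' := by linarith
  subst hvv
  have hww : w = l * w' := by linarith
  refine ⟨mul_left_cancel₀ hv.ne' ?_, rfl, hww⟩
  linarith
end

section
/- Let (x_j) be a sequence of real numbers with x_j → +∞ (respectively x_j → −∞), and let v_j ≥ 0, w_j ≥ 0 be sequences satisfying the normalization 2·w_j + v_j·(|x_j| + |x_j − 1|) = 1 for all j. Then for every k ∈ ℤ, the values w_j + v_j·|x_j − k| converge to 1/2; that is, the functions k ↦ w_j + v_j·|x_j − k| converge to the constant function 1/2 in the product topology on ℤ → ℝ. -/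
open Filter Topology

/-- Under the normalization, the mass function differs from `1/2` by at most `v (|k| + 1)`. -/
theorem abs_mass_sub_half_le {x v w : ℝ} (hv : 0 ≤ v)
    (hnorm : 2 * w + v * (|x| + |x - 1|) = 1) (k : ℝ) :
    |w + v * |x - k| - 1 / 2| ≤ v * (|k| + 1) := by
  have heq : w + v * |x - k| - 1 / 2 = v * (|x - k| - (|x| + |x - 1|) / 2) := by
    linear_combination hnorm / 2
  rw [heq, abs_mul, abs_of_nonneg hv]
  refine mul_le_mul_of_nonneg_left ?_ hv
  have h₁ := abs_le.1 (abs_abs_sub_abs_le (x - k) x)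
  have h₂ := abs_le.1 (abs_abs_sub_abs_le (x - 1) x)
  simp only [sub_sub_cancel_left, abs_neg, abs_one] at h₁ h₂
  rw [abs_le]
  constructor <;> linarith [h₁.1, h₁.2, h₂.1, h₂.2]

/-- Under the normalization, the weights `v` tend to `0` as `|x|` tends to infinity. -/
theorem tendsto_weight_zero {ι : Type*} {l : Filter ι} {x v w : ι → ℝ} (hv : ∀ j, 0 ≤ v j)
    (hw : ∀ j, 0 ≤ w j) (hnorm : ∀ j, 2 * w j + v j * (|x j| + |x j - 1|) = 1)
    (hx : Tendsto (fun j => |x j|) l atTop) : Tendsto v l (𝓝 0) := by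
  refine squeeze_zero' (Eventually.of_forall hv) ?_ hx.inv_tendsto_atTop
  filter_upwards [hx.eventually_gt_atTop 0] with j hj
  rw [Pi.inv_apply, ← one_div, le_div_iff₀ hj]
  nlinarith [hnorm j, hw j, mul_nonneg (hv j) (abs_nonneg (x j - 1))]

/-- If `x_j → ±∞` and `v_j, w_j ≥ 0` satisfy the normalization
`2 w_j + v_j (|x_j| + |x_j − 1|) = 1`, then the normalized mass functions
`k ↦ w_j + v_j |x_j − k|` converge in the product topology on `ℤ → ℝ` to the
constant function `1/2`; in particular each value converges to `1/2`. -/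
theorem stmt_14 (x v w : ℕ → ℝ) (hv : ∀ j, 0 ≤ v j) (hw : ∀ j, 0 ≤ w j)
    (hnorm : ∀ j, 2 * w j + v j * (|x j| + |x j - 1|) = 1)
    (hx : Tendsto x atTop atTop ∨ Tendsto x atTop atBot) :
    (∀ k : ℤ, Tendsto (fun j => w j + v j * |x j - (k : ℝ)|) atTop (𝓝 (1 / 2))) ∧
    Tendsto (fun j => fun k : ℤ => w j + v j * |x j - (k : ℝ)|) atTop
      (𝓝 fun _ : ℤ => (1 / 2 : ℝ)) := by
  have habs : Tendsto (fun j => |x j|) atTop atTop :=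
    hx.elim tendsto_abs_atTop_atTop.comp tendsto_abs_atBot_atTop.comp
  have hvzero := tendsto_weight_zero hv hw hnorm habs
  have hpt : ∀ k : ℤ, Tendsto (fun j => w j + v j * |x j - (k : ℝ)|) atTop (𝓝 (1 / 2)) := by
    intro k
    rw [tendsto_iff_dist_tendsto_zero]
    refine squeeze_zero (fun _ => dist_nonneg)
      (fun j => abs_mass_sub_half_le (hv j) (hnorm j) k) ?_
    simpa using hvzero.mul_const (|(k : ℝ)| + 1)
  exact ⟨hpt, tendsto_pi_nhds.2 hpt⟩
end

section
/- Let x ∈ ℝ, v ≥ 0, w ≥ 0 with (v, w) ≠ (0, 0), let f : ℤ → ℝ be f(k) = w + v·|x − k|, and suppose there exists λ > 0 such that f(k − 1) = λ·f(k) for all k ∈ ℤ. Then v = 0, λ = 1, and f is the constant function with value w. -/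
/-- The constant function is the unique point, up to scaling, among the tent
functions `k ↦ w + v·|x − k|` that is invariant (projectively) under the shift
`f ↦ (k ↦ f (k − 1))`. -/
theorem stmt_16 (x v w : ℝ) (hv : 0 ≤ v) (hw : 0 ≤ w) (hvw : (v, w) ≠ (0, 0))
    (f : ℤ → ℝ) (hf : ∀ k : ℤ, f k = w + v * |x - (k : ℝ)|)
    (l : ℝ) (hl : 0 < l) (hshift : ∀ k : ℤ, f (k - 1) = l * f k) :
    v = 0 ∧ l = 1 ∧ ∀ k : ℤ, f k = w := by
  have left (k : ℤ) (hk : (k : ℝ) ≤ x) : f k = w + v * (x - k) := by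
    rw [hf, abs_of_nonneg (sub_nonneg.2 hk)]
  -- Three consecutive values to the left of `x` are in arithmetic and geometric progression.
  have hn : ((⌊x⌋ : ℤ) : ℝ) ≤ x := Int.floor_le x
  generalize ⌊x⌋ = n at hn
  have h₀ := left n hn
  have h₁ := left (n - 1) (by push_cast; linarith)
  have h₂ := left (n - 1 - 1) (by push_cast; linarith)
  push_cast at h₁ h₂
  have geom : f (n - 1) ^ 2 = f n * f (n - 1 - 1) := by
    rw [hshift (n - 1), hshift n]
    ring
  have v_eq : v = 0 := by
    rw [h₀, h₁, h₂] at geom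
    exact pow_eq_zero_iff two_ne_zero |>.1 (by linear_combination geom)
  have const (k : ℤ) : f k = w := by simp [hf, v_eq]
  have w_ne : w ≠ 0 := fun h => hvw (by rw [v_eq, h])
  have hl_eq := hshift 0
  rw [const, const] at hl_eq
  exact ⟨v_eq, mul_right_cancel₀ w_ne (by rw [one_mul, ← hl_eq]), const⟩
end

section
/- Fix a real number q > 1 and define P : ℤ → ℝ by P(k) = (q^{−k} − 1)/(q − 1) for k ≤ 0 and P(k) = (q − q^{1−k})/(q − 1) for k ≥ 0. Define G : ℝ → (ℤ → ℝ) by G(x)(k) = (1 − u)·q^{−n}·P(k − n) + u·q^{−n−1}·P(k − n − 1), where n = ⌊x⌋ and u = x − ⌊x⌋. Then G is continuous (with the product topology on ℤ → ℝ), and G satisfies the equivariance G(x + 1)(k) = q^{−1}·G(x)(k − 1) for all x ∈ ℝ and k ∈ ℤ. -/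
open Filter Topology

/-- The `q`-mass vertex function. -/
noncomputable def P (q : ℝ) (k : ℤ) : ℝ :=
  if k ≤ 0 then (q ^ (-k) - 1) / (q - 1) else (q - q ^ (1 - k)) / (q - 1)

/-- The `q`-analogue of the boundary parametrization: on each interval
`[n, n+1]`, `G` linearly interpolates between the rescaled vertex `q`-mass
functions `q^(−n)·P (· − n)` and `q^(−n−1)·P (· − n − 1)`. -/
noncomputable def G (q : ℝ) (x : ℝ) (k : ℤ) : ℝ :=
  (1 - (x - ⌊x⌋)) * q ^ (-⌊x⌋) * P q (k - ⌊x⌋) +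
    (x - ⌊x⌋) * q ^ (-⌊x⌋ - 1) * P q (k - ⌊x⌋ - 1)

/-- The piecewise linear interpolation of a function on `ℤ` is continuous. -/
theorem continuous_int_interpolation (f : ℤ → ℝ) :
    Continuous fun x : ℝ => (1 - Int.fract x) * f ⌊x⌋ + Int.fract x * f (⌊x⌋ + 1) := by
  rw [continuous_iff_continuousAt]
  intro x
  set n : ℤ := ⌊x⌋ with hn
  have hlocal : (fun y : ℝ => f n + max (y - n) 0 * (f (n + 1) - f n)
      + min (y - n) 0 * (f n - f (n - 1))) =ᶠ[𝓝 x]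
      fun y : ℝ => (1 - Int.fract y) * f ⌊y⌋ + Int.fract y * f (⌊y⌋ + 1) := by
    have hx : x ∈ Set.Ioo ((n : ℝ) - 1) (n + 1) :=
      ⟨by linarith [Int.floor_le x], Int.lt_floor_add_one x⟩
    filter_upwards [isOpen_Ioo.mem_nhds hx] with y hy
    rcases le_or_gt (n : ℝ) y with h | h
    · have hfloor : ⌊y⌋ = n := Int.floor_eq_iff.2 ⟨h, hy.2⟩
      rw [Int.fract, hfloor, max_eq_left (by linarith), min_eq_right (by linarith)]
      ring
    · have hfloor : ⌊y⌋ = n - 1 := by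
        rw [Int.floor_eq_iff]
        push_cast
        exact ⟨hy.1.le, by linarith⟩
      rw [Int.fract, hfloor, max_eq_right (by linarith), min_eq_left (by linarith),
        sub_add_cancel]
      push_cast
      ring
  refine ContinuousAt.congr ?_ hlocal
  fun_prop

/-- For `q > 1`, the parametrization `G` is continuous into `ℤ → ℝ` with the
product topology, and it is `T`-equivariant: `G (x + 1) k = q⁻¹ · G x (k − 1)`. -/
theorem stmt_18 (q : ℝ) (hq : 1 < q) :
    Continuous (fun x : ℝ => fun k : ℤ => G q x k) ∧
    ∀ (x : ℝ) (k : ℤ), G q (x + 1) k = q⁻¹ * G q x (k - 1) := by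
  constructor
  · refine continuous_pi fun k => ?_
    convert continuous_int_interpolation fun n => q ^ (-n) * P q (k - n) using 2 with x
    simp only [G, Int.fract, neg_add', sub_add_eq_sub_sub]
    ring
  · intro x k
    have hq0 : q ≠ 0 := by positivity
    have hshift : x + 1 - ((⌊x⌋ + 1 : ℤ) : ℝ) = x - ⌊x⌋ := by
      push_cast
      ring
    have hindex : k - (⌊x⌋ + 1) = k - 1 - ⌊x⌋ := by ring
    simp only [G, Int.floor_add_one, hshift, hindex, neg_add', zpow_sub_one₀ hq0]
    ring
end

section
/- Fix a real number q > 1, define P : ℤ → ℝ by P(k) = (q^{−k} − 1)/(q − 1) for k ≤ 0 and P(k) = (q − q^{1−k})/(q − 1) for k ≥ 0, and define G : ℝ → (ℤ → ℝ) by G(x)(k) = (1 − u)·q^{−n}·P(k − n) + u·q^{−n−1}·P(k − n − 1), where n = ⌊x⌋ and u = x − ⌊x⌋. Then: (i) for each k ∈ ℤ, G(x)(k) → q^{−k}/(q − 1) as x → +∞; and (ii) for each k ∈ ℤ, the ratio G(x)(k)/G(x)(0) → 1 as x → −∞. -/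
open Filter Topology

theorem P_of_nonpos (q : ℝ) {k : ℤ} (hk : k ≤ 0) : P q k = (q ^ (-k) - 1) / (q - 1) :=
  if_pos hk

theorem P_of_nonneg (q : ℝ) {k : ℤ} (hk : 0 ≤ k) : P q k = (q - q ^ (1 - k)) / (q - 1) := by
  rcases hk.eq_or_lt with rfl | hk
  · simp [P]
  · exact if_neg hk.not_ge

theorem zpow_mul_P_of_le {q : ℝ} (hq : q ≠ 0) {k n : ℤ} (h : k ≤ n) :
    q ^ (-n) * P q (k - n) = (q ^ (-k) - q ^ (-n)) / (q - 1) := by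
  rw [P_of_nonpos q (by lia), ← mul_div_assoc, mul_sub, ← zpow_add₀ hq]
  ring_nf

theorem zpow_mul_P_of_ge {q : ℝ} (hq : q ≠ 0) {k n : ℤ} (h : n ≤ k) :
    q ^ (-n) * P q (k - n) = (q * q ^ (-n) - q ^ (1 - k)) / (q - 1) := by
  rw [P_of_nonneg q (by lia), ← mul_div_assoc, mul_sub, ← zpow_add₀ hq]
  ring_nf

/-- The piecewise linear interpolation of `n ↦ q ^ (-n)`. -/
noncomputable def interpZPow (q x : ℝ) : ℝ :=
  (1 - (x - ⌊x⌋)) * q ^ (-⌊x⌋) + (x - ⌊x⌋) * q ^ (-⌊x⌋ - 1)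

theorem interpZPow_mem_Icc {q : ℝ} (hq : 1 < q) (x : ℝ) :
    interpZPow q x ∈ Set.Icc (q ^ (-⌊x⌋ - 1)) (q ^ (-⌊x⌋)) := by
  have h : q ^ (-⌊x⌋ - 1) ≤ q ^ (-⌊x⌋) := zpow_le_zpow_right₀ hq.le (by lia)
  have h0 := Int.floor_le x
  have h1 := (Int.lt_floor_add_one x).le
  unfold interpZPow
  constructor <;> nlinarith

theorem tendsto_zpow_atTop_of_one_lt {q : ℝ} (hq : 1 < q) :
    Tendsto (fun n : ℤ => q ^ n) atTop atTop := by
  refine tendsto_atTop.2 fun b => ?_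
  obtain ⟨m, hm⟩ := pow_unbounded_of_one_lt b hq
  filter_upwards [eventually_ge_atTop (m : ℤ)] with n hn
  calc b ≤ q ^ (m : ℤ) := by simpa using hm.le
    _ ≤ q ^ n := zpow_le_zpow_right₀ hq.le hn

theorem tendsto_interpZPow_atTop {q : ℝ} (hq : 1 < q) :
    Tendsto (interpZPow q) atTop (𝓝 0) := by
  have h : Tendsto (fun x : ℝ => q ^ (-⌊x⌋)) atTop (𝓝 0) := by
    simp only [zpow_neg]
    exact ((tendsto_zpow_atTop_of_one_lt hq).comp tendsto_floor_atTop).inv_tendsto_atTop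
  refine squeeze_zero (fun x => ?_) (fun x => (interpZPow_mem_Icc hq x).2) h
  exact (zpow_pos (by linarith) _).le.trans (interpZPow_mem_Icc hq x).1

theorem tendsto_interpZPow_atBot {q : ℝ} (hq : 1 < q) :
    Tendsto (interpZPow q) atBot atTop := by
  refine tendsto_atTop_mono (fun x => (interpZPow_mem_Icc hq x).1) ?_
  refine (tendsto_zpow_atTop_of_one_lt hq).comp ?_
  exact tendsto_atTop_add_const_right _ (-1)
    (tendsto_neg_atBot_atTop.comp tendsto_floor_atBot)

theorem G_eq_of_le_floor {q : ℝ} (hq : q ≠ 0) {k : ℤ} {x : ℝ} (h : k ≤ ⌊x⌋) :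
    G q x k = (q ^ (-k) - interpZPow q x) / (q - 1) := by
  have h₁ := zpow_mul_P_of_le hq h
  have h₂ := zpow_mul_P_of_le hq (show k ≤ ⌊x⌋ + 1 by lia)
  rw [neg_add', ← sub_sub] at h₂
  rw [G, mul_assoc, mul_assoc, h₁, h₂, interpZPow]
  ring

theorem G_eq_of_floor_lt {q : ℝ} (hq : q ≠ 0) {k : ℤ} {x : ℝ} (h : ⌊x⌋ < k) :
    G q x k = (q * interpZPow q x - q ^ (1 - k)) / (q - 1) := by
  have h₁ := zpow_mul_P_of_ge hq h.le
  have h₂ := zpow_mul_P_of_ge hq (show ⌊x⌋ + 1 ≤ k by lia)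
  rw [neg_add', ← sub_sub] at h₂
  rw [G, mul_assoc, mul_assoc, h₁, h₂, interpZPow]
  ring

/-- For `q > 1`: (i) for each `k`, `G x k → q^(−k)/(q − 1)` as `x → +∞`
(pointwise convergence to the `q`-hom functional), and (ii) for each `k`, the
normalized values `G x k / G x 0 → 1` as `x → −∞` (projective convergence to the
constant function). -/
theorem stmt_19 (q : ℝ) (hq : 1 < q) :
    (∀ k : ℤ, Tendsto (fun x : ℝ => G q x k) atTop (𝓝 (q ^ (-k) / (q - 1)))) ∧
    (∀ k : ℤ, Tendsto (fun x : ℝ => G q x k / G q x 0) atBot (𝓝 1)) := by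
  have hq0 : q ≠ 0 := by positivity
  have hq1 : q - 1 ≠ 0 := by linarith
  refine ⟨fun k => ?_, fun k => ?_⟩
  · have h := ((tendsto_interpZPow_atTop hq).const_sub (q ^ (-k))).div_const (q - 1)
    rw [sub_zero] at h
    refine h.congr' ?_
    filter_upwards [tendsto_floor_atTop.eventually_ge_atTop k] with x hx
    exact (G_eq_of_le_floor hq0 hx).symm
  · have hD : Tendsto (fun x => q * interpZPow q x - q) atBot atTop :=
      tendsto_atTop_add_const_right _ (-q)
        ((tendsto_interpZPow_atBot hq).const_mul_atTop (by linarith))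
    have h := (hD.const_div_atTop (q - q ^ (1 - k))).const_add 1
    rw [add_zero] at h
    refine h.congr' ?_
    filter_upwards [hD.eventually_gt_atTop 0, tendsto_floor_atBot.eventually_lt_atBot k,
      tendsto_floor_atBot.eventually_lt_atBot 0] with x hx hk h0
    rw [G_eq_of_floor_lt hq0 hk, G_eq_of_floor_lt hq0 h0, div_div_div_cancel_right₀ hq1,
      sub_zero, zpow_one, one_add_div hx.ne']
    ring
end
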